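/- The function v belongs to R, and ∫₀¹ v(t) dt = sup{∫₀¹ b(t) dt : b ∈ R} = √(2 log 2)·∫₀¹ √(â(t)) dt. -/

import Mathlib

open MeasureTheory Set Filter

/-- Riemann integrability of `a` on `[0,1]`, encoded via the Lebesgue criterion:
`a` is bounded on `[0,1]`, almost everywhere continuous on `[0,1]`, and (Lebesgue)
integrable on `[0,1]`. -/
def RiemannIntegrableOn01 (a : ℝ → ℝ) : Prop :=
  IntegrableOn a (Set.Icc 0 1) volume ∧
  (∀ᵐ s ∂(volume.restrict (Set.Icc (0:ℝ) 1)), ContinuousAt a s) ∧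
  ∃ C : ℝ, ∀ s ∈ Set.Icc (0:ℝ) 1, |a s| ≤ C

/-- The energy functional: `Ecost a b t` is `∫₀ᵗ b(s)²/(2a(s)) ds`, valued in `[0,∞]`,
with the conventions `0/0 = 0` and `c/0 = ∞` for `c ≠ 0`.
The condition `E(b,t) ≤ 0` of the paper, i.e. `-(log 2)·t + ∫₀ᵗ b(s)²/(2a(s)) ds ≤ 0`,
then reads `Ecost a b t ≤ ENNReal.ofReal (Real.log 2 * t)`. -/
noncomputable def Ecost (a b : ℝ → ℝ) (t : ℝ) : ENNReal :=
  ∫⁻ s in Set.Ioc (0:ℝ) t,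
    (if a s = 0 then (if b s = 0 then 0 else ⊤) else ENNReal.ofReal (b s ^ 2 / (2 * a s)))

/-- Membership in the class `R` of measurable functions `b : [0,1] → ℝ` with
`E(b,t) ≤ 0` for all `t ∈ [0,1]`. -/
def memR (a b : ℝ → ℝ) : Prop :=
  AEMeasurable b (volume.restrict (Set.Icc (0:ℝ) 1)) ∧
  ∀ t ∈ Set.Icc (0:ℝ) 1, Ecost a b t ≤ ENNReal.ofReal (Real.log 2 * t)

/-- `v(s) = a(s)·√(2 log 2 / â(s))` when `â(s) > 0`, and `v(s) = 0` otherwise. -/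
noncomputable def vfun (a ahat : ℝ → ℝ) (s : ℝ) : ℝ :=
  if 0 < ahat s then a s * Real.sqrt (2 * Real.log 2 / ahat s) else 0

/-- The fundamental theorem of calculus for left derivatives. -/
theorem integral_eq_sub_of_hasDeriv_left_of_le {f f' : ℝ → ℝ} {a b : ℝ} (hab : a ≤ b)
    (hcont : ContinuousOn f (Icc a b))
    (hderiv : ∀ x ∈ Ioo a b, HasDerivWithinAt f (f' x) (Iio x) x)
    (f'int : IntervalIntegrable f' volume a b) : ∫ y in a..b, f' y = f b - f a := by
  have key := intervalIntegral.integral_eq_sub_of_hasDeriv_right_of_le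
    (f := fun x => -f (-x)) (f' := fun x => f' (-x)) (neg_le_neg hab) ?_ ?_ ?_
  · rw [intervalIntegral.integral_comp_neg] at key
    simp only [neg_neg] at key
    linarith
  · refine (hcont.comp continuous_neg.continuousOn fun x hx => ?_).neg
    exact ⟨by linarith [hx.2], by linarith [hx.1]⟩
  · intro x hx
    have h1 : HasDerivWithinAt f (f' (-x)) (Iio (-x)) (-x) :=
      hderiv (-x) ⟨by linarith [hx.2], by linarith [hx.1]⟩
    have h2 : HasDerivWithinAt (fun y : ℝ => -y) (-1) (Ioi x) x :=
      (hasDerivAt_neg x).hasDerivWithinAt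
    have h3 := (h1.comp x h2 fun y (hy : x < y) => neg_lt_neg hy).neg
    exact h3.congr_deriv (by simp)
  · simpa using (f'int.comp_sub_left 0).symm

/-- Where the least concave majorant lies strictly above a continuous function, it is affine. -/
theorem exists_affine_of_lt_least_concave {A F : ℝ → ℝ}
    (hAc : ContinuousOn A (Icc 0 1)) (hFc : ContinuousOn F (Icc 0 1))
    (hF : ConcaveOn ℝ (Icc 0 1) F) (hAF : ∀ t ∈ Icc (0:ℝ) 1, A t ≤ F t)
    (hleast : ∀ g : ℝ → ℝ, ConcaveOn ℝ (Icc 0 1) g →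
      (∀ t ∈ Icc (0:ℝ) 1, A t ≤ g t) → ∀ t ∈ Icc (0:ℝ) 1, F t ≤ g t)
    {u : ℝ} (hu : u ∈ Ioo (0:ℝ) 1) (hlt : A u < F u) :
    ∃ x y k, 0 < x ∧ x < u ∧ u < y ∧ y < 1 ∧ ∀ z ∈ Icc x y, F z = F x + k * (z - x) := by
  obtain ⟨m, hm1, hm2⟩ := exists_between hlt
  have hnhds : Icc (0:ℝ) 1 ∈ nhds u := Icc_mem_nhds hu.1 hu.2
  have h1 : ∀ᶠ z in nhds u, A z < m :=
    (hAc.continuousAt hnhds).eventually (gt_mem_nhds hm1)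
  have h2 : ∀ᶠ z in nhds u, m < F z :=
    (hFc.continuousAt hnhds).eventually (lt_mem_nhds hm2)
  obtain ⟨e, he, hball⟩ := Metric.eventually_nhds_iff.1
    (h1.and (h2.and (Ioo_mem_nhds hu.1 hu.2)))
  have hnear : ∀ z ∈ Icc (u - e / 2) (u + e / 2), A z < m ∧ m < F z ∧ z ∈ Ioo (0:ℝ) 1 := by
    intro z hz
    apply hball
    rw [Real.dist_eq, abs_lt]
    constructor <;> linarith [hz.1, hz.2]
  set x := u - e / 2 with hx
  set y := u + e / 2 with hy
  have hxy : x < y := by linarith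
  have nx := hnear x ⟨le_rfl, hxy.le⟩
  have ny := hnear y ⟨hxy.le, le_rfl⟩
  have hxI : x ∈ Icc (0:ℝ) 1 := Ioo_subset_Icc_self nx.2.2
  have hyI : y ∈ Icc (0:ℝ) 1 := Ioo_subset_Icc_self ny.2.2
  set k := (F y - F x) / (y - x) with hk
  have hkxy : k * (y - x) = F y - F x := div_mul_cancel₀ _ (by linarith)
  set l : ℝ → ℝ := fun z => F x + k * (z - x) with hl
  have hlconc : ConcaveOn ℝ (Icc (0:ℝ) 1) l := by
    refine ⟨convex_Icc 0 1, fun p _ q _ s t _ _ hst => le_of_eq ?_⟩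
    simp only [hl, smul_eq_mul]
    linear_combination (F x - k * x) * hst
  have hinside : ∀ z ∈ Icc x y, l z ≤ F z := by
    intro z hz
    rcases hz.1.eq_or_lt with h | h
    · simp [hl, h]
    rcases hz.2.eq_or_lt with h' | h'
    · simp only [hl, h', hkxy]; linarith
    have hs := hF.slope_anti_adjacent hxI hyI h h'
    rw [div_le_div_iff₀ (by linarith) (by linarith)] at hs
    have : k * (z - x) * (y - x) ≤ (F z - F x) * (y - x) := by
      have : k * (z - x) * (y - x) = (F y - F x) * (z - x) := by rw [← hkxy]; ring
      nlinarith
    have := le_of_mul_le_mul_right this (by linarith)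
    simp only [hl]; linarith
  have hmaj : ∀ z ∈ Icc (0:ℝ) 1, A z ≤ l z := by
    intro z hz
    rcases lt_or_ge z x with h | h
    · refine (hAF z hz).trans ?_
      have hs := hF.slope_anti_adjacent hz hyI h hxy
      rw [← hk, le_div_iff₀ (by linarith)] at hs
      simp only [hl]; linarith
    rcases lt_or_ge y z with h' | h'
    · refine (hAF z hz).trans ?_
      have hs := hF.slope_anti_adjacent hxI hz hxy h'
      rw [← hk, div_le_iff₀ (by linarith)] at hs
      simp only [hl]; linarith
    · refine (hnear z ⟨h, h'⟩).1.le.trans ?_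
      have : m * (y - x) ≤ l z * (y - x) := by
        have : l z * (y - x) = F x * (y - z) + F y * (z - x) := by
          simp only [hl]; linear_combination (z - x) * hkxy
        rw [this]
        nlinarith [mul_nonneg (sub_nonneg.2 nx.2.1.le) (sub_nonneg.2 h'),
          mul_nonneg (sub_nonneg.2 ny.2.1.le) (sub_nonneg.2 h)]
      exact le_of_mul_le_mul_right this (by linarith)
  refine ⟨x, y, k, nx.2.2.1, by linarith, by linarith, ny.2.2.2, fun z hz => ?_⟩
  refine le_antisymm ?_ (hinside z hz)
  have hzI := Ioo_subset_Icc_self (hnear z hz).2.2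
  exact (hleast (F ⊓ l) (hF.inf hlconc)
    (fun t ht => le_inf (hAF t ht) (hmaj t ht)) z hzI).trans inf_le_right

/-- The left derivative of the least concave majorant is locally constant where the majorant
lies strictly above the function. -/
theorem exists_leftDeriv_eq_of_lt_least_concave {A F f : ℝ → ℝ}
    (hAc : ContinuousOn A (Icc 0 1)) (hFc : ContinuousOn F (Icc 0 1))
    (hF : ConcaveOn ℝ (Icc 0 1) F) (hAF : ∀ t ∈ Icc (0:ℝ) 1, A t ≤ F t)
    (hleast : ∀ g : ℝ → ℝ, ConcaveOn ℝ (Icc 0 1) g →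
      (∀ t ∈ Icc (0:ℝ) 1, A t ≤ g t) → ∀ t ∈ Icc (0:ℝ) 1, F t ≤ g t)
    (hf : ∀ t ∈ Ioc (0:ℝ) 1, HasDerivWithinAt F (f t) (Iic t) t)
    {u : ℝ} (hu : u ∈ Ioo (0:ℝ) 1) (hlt : A u < F u) :
    ∃ x y, 0 < x ∧ x < u ∧ u < y ∧ y < 1 ∧ f x = f y := by
  obtain ⟨x, y, k, hx0, hxu, huy, hy1, haff⟩ :=
    exists_affine_of_lt_least_concave hAc hFc hF hAF hleast hu hlt
  have key : ∀ z ∈ Ioc x y, f z = k := by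
    intro z hz
    have h1 := hf z ⟨by linarith [hz.1], by linarith [hz.2]⟩
    have h2 : HasDerivWithinAt (fun w => F x + k * (w - x)) k (Iic z) z := by
      have := (((hasDerivAt_id z).sub_const x).const_mul k).const_add (F x)
      simpa using this.hasDerivWithinAt
    have h3 : HasDerivWithinAt F k (Iic z) z := by
      refine h2.congr_of_eventuallyEq ?_ (haff z ⟨hz.1.le, hz.2⟩)
      filter_upwards [self_mem_nhdsWithin, mem_nhdsWithin_of_mem_nhds (Ioi_mem_nhds hz.1)]
        with w hw hw'
      exact haff w ⟨le_of_lt hw', le_trans hw hz.2⟩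
    exact (uniqueDiffWithinAt_Iic z).eq_deriv _ h1 h3
  refine ⟨(x + u) / 2, y, by linarith, by linarith, huy, hy1, ?_⟩
  rw [key _ ⟨by linarith, by linarith⟩, key y ⟨by linarith, le_rfl⟩]

/-- `g` is an antitone function on `(0,1]` whose primitive dominates that of `a`, with the same
total integral, and which is locally constant wherever the domination is strict. -/
structure IsFlatMajorant (a g : ℝ → ℝ) : Prop where
  nonneg_left : ∀ s ∈ Ioc (0:ℝ) 1, 0 ≤ a s
  integrableOn_left : IntegrableOn a (Ioc 0 1)
  nonneg_right : ∀ s ∈ Ioc (0:ℝ) 1, 0 ≤ g s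
  antitone : Antitone g
  integral_le : ∀ t ∈ Icc (0:ℝ) 1, ∫ s in (0:ℝ)..t, a s ≤ ∫ s in (0:ℝ)..t, g s
  integral_eq : ∫ s in (0:ℝ)..1, a s = ∫ s in (0:ℝ)..1, g s
  flat : ∀ u ∈ Ioo (0:ℝ) 1, ∫ s in (0:ℝ)..u, a s < ∫ s in (0:ℝ)..u, g s →
    ∃ x y, 0 < x ∧ x < u ∧ u < y ∧ y < 1 ∧ g x = g y

/-- The left derivative of the least concave majorant of `∫₀ᵗ a` extends to an antitone function
on the line that is a flat majorant of `a`. -/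
theorem exists_isFlatMajorant_of_least_concave {a F f : ℝ → ℝ} {C : ℝ}
    (ha_nonneg : ∀ s ∈ Icc (0:ℝ) 1, 0 ≤ a s) (ha_int : IntegrableOn a (Icc 0 1))
    (hC : ∀ s ∈ Icc (0:ℝ) 1, a s ≤ C)
    (hF : ConcaveOn ℝ (Icc 0 1) F) (hAF : ∀ t ∈ Icc (0:ℝ) 1, ∫ s in (0:ℝ)..t, a s ≤ F t)
    (hleast : ∀ g : ℝ → ℝ, ConcaveOn ℝ (Icc 0 1) g →
      (∀ t ∈ Icc (0:ℝ) 1, ∫ s in (0:ℝ)..t, a s ≤ g t) → ∀ t ∈ Icc (0:ℝ) 1, F t ≤ g t)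
    (hf : ∀ t ∈ Ioc (0:ℝ) 1, HasDerivWithinAt F (f t) (Iic t) t)
    (hf_nonneg : ∀ t ∈ Ioc (0:ℝ) 1, 0 ≤ f t) (hf_anti : AntitoneOn f (Ioc 0 1)) :
    ∃ g, EqOn f g (Ioc 0 1) ∧ IsFlatMajorant a g := by
  have hint : ∀ t ∈ Icc (0:ℝ) 1, IntervalIntegrable a volume 0 t := fun t ht => by
    rw [intervalIntegrable_iff_integrableOn_Ioc_of_le ht.1]
    exact ha_int.mono_set fun s hs => ⟨hs.1.le, hs.2.trans ht.2⟩
  have hlin : ∀ t ∈ Icc (0:ℝ) 1, F t ≤ C * t := by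
    refine hleast (fun t => C * t) ⟨convex_Icc 0 1, fun p _ q _ s t _ _ hst => le_of_eq ?_⟩ ?_
    · simp only [smul_eq_mul]; ring
    · intro t ht
      have := intervalIntegral.integral_mono_on ht.1 (hint t ht)
        (intervalIntegrable_const (c := C)) fun s hs => hC s ⟨hs.1, hs.2.trans ht.2⟩
      simpa [mul_comm] using this
  have htop : ∀ t ∈ Icc (0:ℝ) 1, F t ≤ ∫ s in (0:ℝ)..1, a s := by
    refine hleast (fun _ => _) (concaveOn_const _ (convex_Icc 0 1)) fun t ht => ?_
    refine intervalIntegral.integral_mono_interval le_rfl ht.1 ht.2 ?_ (hint 1 ⟨zero_le_one, le_rfl⟩)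
    exact (ae_restrict_iff' measurableSet_Ioc).2
      (Eventually.of_forall fun s hs => ha_nonneg s ⟨hs.1.le, hs.2⟩)
  have h0I : (0:ℝ) ∈ Icc (0:ℝ) 1 := ⟨le_rfl, zero_le_one⟩
  have h1I : (1:ℝ) ∈ Icc (0:ℝ) 1 := ⟨zero_le_one, le_rfl⟩
  have hF0 : F 0 = 0 := by
    refine le_antisymm (by simpa using hlin 0 h0I) ?_
    simpa using hAF 0 h0I
  have hF1 : F 1 = ∫ s in (0:ℝ)..1, a s := le_antisymm (htop 1 h1I) (hAF 1 h1I)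
  have hpos : ∀ t ∈ Icc (0:ℝ) 1, 0 ≤ F t := fun t ht =>
    (intervalIntegral.integral_nonneg ht.1
      fun s hs => ha_nonneg s ⟨hs.1, hs.2.trans ht.2⟩).trans (hAF t ht)
  have hFc : ContinuousOn F (Icc 0 1) := by
    refine hF.continuousOn_Icc zero_lt_one ?_ (hf 1 ⟨zero_lt_one, le_rfl⟩).continuousWithinAt
    rw [ContinuousWithinAt, hF0]
    have hev : ∀ᶠ t in nhdsWithin (0:ℝ) (Ici 0), t ∈ Icc (0:ℝ) 1 := by
      filter_upwards [self_mem_nhdsWithin, mem_nhdsWithin_of_mem_nhds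
        (Iio_mem_nhds (zero_lt_one (α := ℝ)))] with t h h'
      exact ⟨h, le_of_lt h'⟩
    have hl : Tendsto (fun t => C * t) (nhdsWithin (0:ℝ) (Ici 0)) (nhds 0) := by
      have : Continuous fun t : ℝ => C * t := by fun_prop
      simpa using (this.tendsto 0).mono_left (nhdsWithin_le_nhds (s := Ici 0))
    exact tendsto_of_tendsto_of_tendsto_of_le_of_le' tendsto_const_nhds hl
      (hev.mono hpos) (hev.mono hlin)
  have hAc : ContinuousOn (fun t => ∫ s in (0:ℝ)..t, a s) (Icc 0 1) := by
    have := intervalIntegral.continuousOn_primitive_interval (f := a) (a := 0) (b := 1)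
      (μ := volume) (by rwa [uIcc_of_le zero_le_one])
    rwa [uIcc_of_le zero_le_one] at this
  have hfC : ∀ t ∈ Ioc (0:ℝ) 1, f t ≤ C := by
    intro t ht
    have htI : t ∈ Icc (0:ℝ) 1 := ⟨ht.1.le, ht.2⟩
    have := hF.le_slope_of_hasDerivWithinAt_Iio h0I htI ht.1 ((hf t ht).mono Iio_subset_Iic_self)
    rw [slope_def_field, hF0, sub_zero, sub_zero, le_div_iff₀ ht.1] at this
    exact le_of_mul_le_mul_right (this.trans (hlin t htI)) ht.1
  obtain ⟨g, hg, hfg⟩ := hf_anti.exists_antitone_extension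
    ⟨0, by rintro _ ⟨t, ht, rfl⟩; exact hf_nonneg t ht⟩
    ⟨C, by rintro _ ⟨t, ht, rfl⟩; exact hfC t ht⟩
  have hgF : ∀ t ∈ Icc (0:ℝ) 1, ∫ s in (0:ℝ)..t, g s = F t := by
    intro t ht
    have := integral_eq_sub_of_hasDeriv_left_of_le (f' := g) ht.1
      (hFc.mono (Icc_subset_Icc_right ht.2)) (fun x hx => ?_) (hg.intervalIntegrable)
    · rw [this, hF0, sub_zero]
    · have hx' : x ∈ Ioc (0:ℝ) 1 := ⟨hx.1, hx.2.le.trans ht.2⟩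
      rw [← hfg hx']
      exact (hf x hx').mono Iio_subset_Iic_self
  refine ⟨g, hfg, fun s hs => ha_nonneg s ⟨hs.1.le, hs.2⟩, ha_int.mono_set Ioc_subset_Icc_self,
    fun s hs => hfg hs ▸ hf_nonneg s hs, hg, fun t ht => (hgF t ht).symm ▸ hAF t ht,
    by rw [hgF 1 h1I, hF1], fun u hu hlt => ?_⟩
  rw [hgF u ⟨hu.1.le, hu.2.le⟩] at hlt
  obtain ⟨x, y, hx, hxu, huy, hy, hxy⟩ :=
    exists_leftDeriv_eq_of_lt_least_concave hAc hFc hF hAF hleast hf hu hlt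
  exact ⟨x, y, hx, hxu, huy, hy, by
    rwa [hfg ⟨hx, by linarith⟩, hfg ⟨by linarith, hy.le⟩] at hxy⟩

/-- An initial piece of `(0,1]` is, up to a null set, the interval up to its supremum. -/
theorem ae_eq_Ioc_sSup {S : Set ℝ} (hS : S ⊆ Ioc 0 1)
    (hlow : ∀ s ∈ S, ∀ r, 0 < r → r ≤ s → r ∈ S) : S =ᵐ[volume] Ioc 0 (sSup S) := by
  rcases S.eq_empty_or_nonempty with he | hne
  · simp [he]
  have hnull : ∀ᵐ s : ℝ, s ≠ sSup S := by simp [ae_iff]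
  filter_upwards [hnull] with s hs
  refine propext ⟨fun hsS => ⟨(hS hsS).1, le_csSup ⟨1, fun r hr => (hS hr).2⟩ hsS⟩, fun hsu => ?_⟩
  obtain ⟨r, hr, hsr⟩ := exists_lt_of_lt_csSup hne (lt_of_le_of_ne hsu.2 hs)
  exact hlow r hr s hsu.1 hsr.le

namespace IsFlatMajorant

variable {a g : ℝ → ℝ}

theorem integrableOn_right (h : IsFlatMajorant a g) : IntegrableOn g (Ioc 0 1) :=
  (h.antitone.locallyIntegrable.integrableOn_isCompact isCompact_Icc).mono_set
    Ioc_subset_Icc_self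

theorem ofReal_integral (f : ℝ → ℝ) (hf : IntegrableOn f (Ioc 0 1))
    (hf0 : ∀ s ∈ Ioc (0:ℝ) 1, 0 ≤ f s) {t : ℝ} (ht : t ∈ Icc (0:ℝ) 1) :
    ENNReal.ofReal (∫ s in (0:ℝ)..t, f s) = ∫⁻ s in Ioc 0 t, ENNReal.ofReal (f s) := by
  have hsub : Ioc 0 t ⊆ Ioc (0:ℝ) 1 := Ioc_subset_Ioc_right ht.2
  rw [intervalIntegral.integral_of_le ht.1]
  exact ofReal_integral_eq_lintegral_ofReal (hf.mono_set hsub)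
    ((ae_restrict_iff' measurableSet_Ioc).2 (Eventually.of_forall fun s hs => hf0 s (hsub hs)))

theorem lintegral_le (h : IsFlatMajorant a g) {t : ℝ} (ht : t ∈ Icc (0:ℝ) 1) :
    ∫⁻ s in Ioc 0 t, ENNReal.ofReal (a s) ≤ ∫⁻ s in Ioc 0 t, ENNReal.ofReal (g s) := by
  rw [← ofReal_integral a h.integrableOn_left h.nonneg_left ht,
    ← ofReal_integral g h.integrableOn_right h.nonneg_right ht]
  exact ENNReal.ofReal_le_ofReal (h.integral_le t ht)

/-- On superlevel sets of `g`, the integrals of `a` and `g` agree. -/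
theorem lintegral_superlevel (h : IsFlatMajorant a g) (c : ℝ) :
    ∫⁻ s in g ⁻¹' Ici c ∩ Ioc 0 1, ENNReal.ofReal (a s) =
      ∫⁻ s in g ⁻¹' Ici c ∩ Ioc 0 1, ENNReal.ofReal (g s) := by
  set S := g ⁻¹' Ici c ∩ Ioc (0:ℝ) 1 with hS
  rcases S.eq_empty_or_nonempty with he | hne
  · simp [he]
  set u := sSup S with hu
  have hbdd : BddAbove S := ⟨1, fun s hs => hs.2.2⟩
  have hu1 : u ≤ 1 := csSup_le hne fun s hs => hs.2.2
  have hlt : ∀ s, 0 < s → s < u → c ≤ g s := fun s _ hsu => by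
    obtain ⟨r, hr, hsr⟩ := exists_lt_of_lt_csSup hne hsu
    exact le_trans hr.1 (h.antitone hsr.le)
  have hgt : ∀ s, u < s → s ≤ 1 → 0 < s → g s < c := fun s hus hs1 hs0 => by
    by_contra! hcs
    exact absurd (le_csSup hbdd (⟨hcs, hs0, hs1⟩ : s ∈ S)) (not_le.2 hus)
  have hu0 : 0 < u := by
    obtain ⟨s, hs⟩ := hne
    exact hs.2.1.trans_le (le_csSup hbdd hs)
  have hae : S =ᵐ[volume] Ioc 0 u := ae_eq_Ioc_sSup (fun s hs => hs.2) fun s hs r hr hrs =>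
    ⟨le_trans hs.1 (h.antitone hrs), hr, hrs.trans hs.2.2⟩
  have huI : u ∈ Icc (0:ℝ) 1 := ⟨hu0.le, hu1⟩
  rw [setLIntegral_congr hae, setLIntegral_congr hae,
    ← ofReal_integral a h.integrableOn_left h.nonneg_left huI,
    ← ofReal_integral g h.integrableOn_right h.nonneg_right huI]
  congr 1
  rcases hu1.eq_or_lt with h1 | h1
  · rw [h1]; exact h.integral_eq
  refine le_antisymm (h.integral_le u huI) (not_lt.1 fun hcon => ?_)
  obtain ⟨x, y, hx, hxu, huy, hy, hxy⟩ := h.flat u ⟨hu0, h1⟩ hcon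
  have := hgt y huy hy.le (by linarith)
  linarith [hlt x hx hxu]

theorem aemeasurable_ofReal_left (h : IsFlatMajorant a g) :
    AEMeasurable (fun s => ENNReal.ofReal (a s)) (volume.restrict (Ioc 0 1)) :=
  h.integrableOn_left.aemeasurable.ennreal_ofReal

/-- The measures with densities `a` and `g` agree on functions of `g`. -/
theorem lintegral_mul_comp (h : IsFlatMajorant a g) {φ : ℝ → ENNReal} (hφ : Measurable φ) :
    ∫⁻ s in Ioc 0 1, ENNReal.ofReal (a s) * φ (g s) =
      ∫⁻ s in Ioc 0 1, ENNReal.ofReal (g s) * φ (g s) := by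
  have hg : Measurable g := h.antitone.measurable
  have hgm : AEMeasurable (fun s => ENNReal.ofReal (g s)) (volume.restrict (Ioc (0:ℝ) 1)) :=
    hg.ennreal_ofReal.aemeasurable
  have hmap : (((volume.restrict (Ioc (0:ℝ) 1)).withDensity
      fun s => ENNReal.ofReal (a s)).map g) =
      (((volume.restrict (Ioc (0:ℝ) 1)).withDensity fun s => ENNReal.ofReal (g s)).map g) := by
    have : IsFiniteMeasure ((volume.restrict (Ioc (0:ℝ) 1)).withDensity
        fun s => ENNReal.ofReal (a s)) :=
      isFiniteMeasure_withDensity_ofReal h.integrableOn_left.2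
    refine Measure.ext_of_Ici _ _ fun c => ?_
    have hm := hg (measurableSet_Ici (a := c))
    rw [Measure.map_apply hg measurableSet_Ici, Measure.map_apply hg measurableSet_Ici,
      withDensity_apply _ hm, withDensity_apply _ hm, Measure.restrict_restrict hm]
    exact h.lintegral_superlevel c
  have hφg : Measurable fun s => φ (g s) := hφ.comp hg
  have e1 := lintegral_withDensity_eq_lintegral_mul₀ h.aemeasurable_ofReal_left
    hφg.aemeasurable
  have e2 := lintegral_withDensity_eq_lintegral_mul₀ hgm hφg.aemeasurable
  simp only [Pi.mul_apply] at e1 e2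
  rw [← e1, ← e2, ← lintegral_map hφ hg, ← lintegral_map hφ hg, hmap]

end IsFlatMajorant

/-- If the primitive of `e` is dominated by `K t`, then integrating an antitone function against
`e` gives at most what integrating it against `K` gives. -/
theorem lintegral_mul_antitone_le {e : ℝ → ENNReal} {θ : ℝ → ℝ} {K : ENNReal}
    (he : AEMeasurable e (volume.restrict (Ioc 0 1))) (hθ : Antitone θ) (hθ0 : ∀ s, 0 ≤ θ s)
    (hK : ∀ t ∈ Icc (0:ℝ) 1, ∫⁻ s in Ioc 0 t, e s ≤ K * ENNReal.ofReal t) :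
    ∫⁻ s in Ioc 0 1, e s * ENNReal.ofReal (θ s) ≤
      K * ∫⁻ s in Ioc 0 1, ENNReal.ofReal (θ s) := by
  have hm : Measurable fun s => ENNReal.ofReal (θ s) := hθ.measurable.ennreal_ofReal
  have e1 := lintegral_withDensity_eq_lintegral_mul₀ he hm.aemeasurable
  simp only [Pi.mul_apply] at e1
  rw [← e1, lintegral_eq_lintegral_meas_lt _ (Eventually.of_forall hθ0) hθ.measurable.aemeasurable,
    lintegral_eq_lintegral_meas_lt _ (Eventually.of_forall hθ0) hθ.measurable.aemeasurable,
    ← lintegral_const_mul]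
  · refine lintegral_mono fun c => ?_
    have hS : MeasurableSet {s | c < θ s} := measurableSet_lt measurable_const hθ.measurable
    rw [withDensity_apply _ hS, Measure.restrict_restrict hS, Measure.restrict_apply hS]
    set S := {s | c < θ s} ∩ Ioc (0:ℝ) 1 with hSdef
    have hae : S =ᵐ[volume] Ioc 0 (sSup S) :=
      ae_eq_Ioc_sSup (fun s hs => hs.2) fun s hs r hr hrs =>
        ⟨lt_of_lt_of_le (show c < θ s from hs.1) (hθ hrs), hr, hrs.trans hs.2.2⟩
    rw [setLIntegral_congr hae, measure_congr hae, Real.volume_Ioc, sub_zero]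
    refine hK _ ⟨Real.sSup_nonneg fun s hs => hs.2.1.le, ?_⟩
    exact Real.sSup_le (fun s hs => hs.2.2) zero_le_one
  · refine Antitone.measurable fun c d hcd => measure_mono fun s hs => ?_
    exact lt_of_le_of_lt hcd hs

namespace IsFlatMajorant

variable {a g : ℝ → ℝ}

theorem setLIntegral_mul_comp (h : IsFlatMajorant a g) {φ : ℝ → ENNReal} (hφ : Measurable φ)
    {B : Set ℝ} (hB : MeasurableSet B) :
    ∫⁻ s in g ⁻¹' B ∩ Ioc 0 1, ENNReal.ofReal (a s) * φ (g s) =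
      ∫⁻ s in g ⁻¹' B ∩ Ioc 0 1, ENNReal.ofReal (g s) * φ (g s) := by
  have hm : MeasurableSet (g ⁻¹' B) := h.antitone.measurable hB
  have key := h.lintegral_mul_comp (hφ.indicator hB)
  have hind : ∀ f : ℝ → ENNReal, (fun s => f s * B.indicator φ (g s)) =
      (g ⁻¹' B).indicator fun s => f s * φ (g s) := by
    intro f
    ext s
    by_cases hs : g s ∈ B <;> simp [hs]
  rwa [hind, hind, lintegral_indicator hm, lintegral_indicator hm,
    Measure.restrict_restrict hm] at key

theorem ae_eq_zero (h : IsFlatMajorant a g) :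
    ∀ᵐ s ∂volume.restrict (Ioc (0:ℝ) 1), g s ≤ 0 → a s = 0 := by
  have hm : MeasurableSet (g ⁻¹' Iic 0) := h.antitone.measurable measurableSet_Iic
  have key := h.setLIntegral_mul_comp (φ := fun _ => 1) measurable_const
    (measurableSet_Iic (a := (0:ℝ)))
  simp only [mul_one] at key
  have hz : ∫⁻ s in g ⁻¹' Iic 0 ∩ Ioc 0 1, ENNReal.ofReal (g s) = 0 := by
    rw [setLIntegral_congr_fun (g := fun _ => 0) (hm.inter measurableSet_Ioc)
      fun s hs => ENNReal.ofReal_eq_zero.2 hs.1]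
    simp
  rw [hz, ← Measure.restrict_restrict hm,
    lintegral_eq_zero_iff' (h.aemeasurable_ofReal_left.mono_measure Measure.restrict_le_self)] at key
  have key' := (ae_restrict_iff' hm).1 key
  filter_upwards [key', ae_restrict_mem measurableSet_Ioc] with s hs hsI hg
  exact le_antisymm (ENNReal.ofReal_eq_zero.1 (hs hg)) (h.nonneg_left s hsI)

theorem lintegral_mul_inv_le (h : IsFlatMajorant a g) {t : ℝ} (ht : t ∈ Icc (0:ℝ) 1)
    {ψ : ℝ → ENNReal} (hψ : Measurable ψ) (hψ1 : ∀ x, ENNReal.ofReal x * ψ x ≤ 1) :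
    ∫⁻ s in Ioc 0 t, ENNReal.ofReal (a s) * ψ (g s) ≤ ENNReal.ofReal t := by
  have hS : MeasurableSet (g ⁻¹' Ioi (g t)) := h.antitone.measurable measurableSet_Ioi
  have hST : Ioc 0 t ∩ g ⁻¹' Ioi (g t) = g ⁻¹' Ioi (g t) ∩ Ioc 0 1 := by
    ext s
    refine ⟨fun hs => ⟨hs.2, hs.1.1, hs.1.2.trans ht.2⟩, fun hs => ⟨⟨hs.2.1, ?_⟩, hs.1⟩⟩
    by_contra! hts
    exact absurd (h.antitone hts.le) (not_le.2 hs.1)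
  have hT : MeasurableSet (Ioc 0 t \ g ⁻¹' Ioi (g t)) := measurableSet_Ioc.diff hS
  have hgT : ∀ s ∈ Ioc 0 t \ g ⁻¹' Ioi (g t), g s = g t := fun s hs =>
    le_antisymm (not_lt.1 hs.2) (h.antitone hs.1.2)
  have hle : ∫⁻ s in Ioc 0 t \ g ⁻¹' Ioi (g t), ENNReal.ofReal (a s) ≤
      ∫⁻ s in Ioc 0 t \ g ⁻¹' Ioi (g t), ENNReal.ofReal (g s) := by
    have h1 := h.lintegral_le ht
    rw [← lintegral_inter_add_sdiff (fun s => ENNReal.ofReal (a s)) (Ioc 0 t) hS,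
      ← lintegral_inter_add_sdiff (fun s => ENNReal.ofReal (g s)) (Ioc 0 t) hS, hST] at h1
    have h2 := h.setLIntegral_mul_comp (φ := fun _ => 1) measurable_const
      (measurableSet_Ioi (a := g t))
    simp only [mul_one] at h2
    rw [h2] at h1
    refine ENNReal.le_of_add_le_add_left (ne_of_lt ?_) h1
    exact (h.integrableOn_right.mono_set inter_subset_right).lintegral_lt_top
  calc ∫⁻ s in Ioc 0 t, ENNReal.ofReal (a s) * ψ (g s)
      = (∫⁻ s in g ⁻¹' Ioi (g t) ∩ Ioc 0 1, ENNReal.ofReal (a s) * ψ (g s)) +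
        ∫⁻ s in Ioc 0 t \ g ⁻¹' Ioi (g t), ENNReal.ofReal (a s) * ψ (g s) := by
        rw [← hST, lintegral_inter_add_sdiff _ _ hS]
    _ ≤ (∫⁻ s in g ⁻¹' Ioi (g t) ∩ Ioc 0 1, ENNReal.ofReal (g s) * ψ (g s)) +
        ∫⁻ s in Ioc 0 t \ g ⁻¹' Ioi (g t), ENNReal.ofReal (g s) * ψ (g s) := by
        rw [h.setLIntegral_mul_comp hψ measurableSet_Ioi]
        gcongr 1
        rw [setLIntegral_congr_fun hT fun s hs => by rw [hgT s hs],
          setLIntegral_congr_fun (f := fun s => ENNReal.ofReal (g s) * ψ (g s)) hT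
            (g := fun s => ENNReal.ofReal (g s) * ψ (g t)) fun s hs => by simp only [hgT s hs],
          lintegral_mul_const'' _ (h.aemeasurable_ofReal_left.mono_measure
            (Measure.restrict_mono (sdiff_subset.trans (Ioc_subset_Ioc_right ht.2)) le_rfl)),
          lintegral_mul_const _ h.antitone.measurable.ennreal_ofReal]
        gcongr
    _ = ∫⁻ s in Ioc 0 t, ENNReal.ofReal (g s) * ψ (g s) := by
        rw [← hST, lintegral_inter_add_sdiff _ _ hS]
    _ ≤ ∫⁻ _ in Ioc 0 t, 1 := lintegral_mono fun s => hψ1 (g s)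
    _ = ENNReal.ofReal t := by simp

end IsFlatMajorant

/-- The integrand `y² / (2x)` of `Ecost`, with its conventions at `x = 0`. -/
noncomputable def costDensity (x y : ℝ) : ENNReal :=
  if x = 0 then (if y = 0 then 0 else ⊤) else ENNReal.ofReal (y ^ 2 / (2 * x))

theorem measurable_costDensity : Measurable fun p : ℝ × ℝ => costDensity p.1 p.2 := by
  unfold costDensity
  refine Measurable.ite (measurable_fst (measurableSet_singleton 0)) ?_ (by fun_prop)
  exact Measurable.ite (measurable_snd (measurableSet_singleton 0)) measurable_const
    measurable_const

theorem ofReal_le_costDensity_mul_add {x y θ : ℝ} (hx : 0 ≤ x) (hθ : 0 < θ) :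
    ENNReal.ofReal y ≤ costDensity x y * ENNReal.ofReal θ +
      ENNReal.ofReal x * ENNReal.ofReal (1 / (2 * θ)) := by
  unfold costDensity
  rcases hx.eq_or_lt with rfl | hx
  · by_cases hy : y = 0
    · simp [hy]
    · simp [hy, ENNReal.top_mul, hθ]
  · rw [if_neg hx.ne', ← ENNReal.ofReal_mul (by positivity), ← ENNReal.ofReal_mul hx.le,
      ← ENNReal.ofReal_add (by positivity) (by positivity)]
    refine ENNReal.ofReal_le_ofReal ?_
    have : y ^ 2 / (2 * x) * θ + x * (1 / (2 * θ)) - y = (y * θ - x) ^ 2 / (2 * x * θ) := by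
      field_simp
      ring
    have : 0 ≤ (y * θ - x) ^ 2 / (2 * x * θ) := by positivity
    linarith

theorem integral_le_toReal_lintegral {α : Type*} [MeasurableSpace α] (μ : Measure α) (f : α → ℝ) :
    ∫ x, f x ∂μ ≤ (∫⁻ x, ENNReal.ofReal (f x) ∂μ).toReal := by
  by_cases hi : Integrable f μ
  · rw [integral_eq_lintegral_pos_part_sub_lintegral_neg_part hi]
    exact sub_le_self _ ENNReal.toReal_nonneg
  · rw [integral_undef hi]
    exact ENNReal.toReal_nonneg

namespace IsFlatMajorant

variable {a g : ℝ → ℝ}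

theorem vfun_nonneg (h : IsFlatMajorant a g) {s : ℝ} (hs : s ∈ Ioc (0:ℝ) 1) : 0 ≤ vfun a g s := by
  unfold vfun
  split_ifs
  · exact mul_nonneg (h.nonneg_left s hs) (Real.sqrt_nonneg _)
  · exact le_rfl

theorem aemeasurable_vfun (h : IsFlatMajorant a g) :
    AEMeasurable (vfun a g) (volume.restrict (Ioc 0 1)) := by
  have hg : Measurable g := h.antitone.measurable
  have hφ : Measurable fun x : ℝ => if 0 < x then √(2 * Real.log 2 / x) else 0 :=
    Measurable.ite measurableSet_Ioi (by fun_prop) measurable_const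
  have : vfun a g = fun s => a s * (if 0 < g s then √(2 * Real.log 2 / g s) else 0) := by
    ext s
    simp [vfun]
  rw [this]
  exact h.integrableOn_left.aemeasurable.mul (hφ.comp hg).aemeasurable

theorem memR_vfun (h : IsFlatMajorant a g) : memR a (vfun a g) := by
  have hlog : 0 < Real.log 2 := Real.log_pos one_lt_two
  refine ⟨?_, fun t ht => ?_⟩
  · rw [← restrict_Ioc_eq_restrict_Icc]
    exact h.aemeasurable_vfun
  set ψ : ℝ → ENNReal := fun x => if 0 < x then ENNReal.ofReal (1 / x) else 0 with hψ
  have hψm : Measurable ψ := Measurable.ite measurableSet_Ioi (by fun_prop) measurable_const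
  have hψ1 : ∀ x, ENNReal.ofReal x * ψ x ≤ 1 := by
    intro x
    by_cases hx : 0 < x
    · simp only [hψ, if_pos hx]
      rw [← ENNReal.ofReal_mul hx.le, mul_one_div_cancel hx.ne', ENNReal.ofReal_one]
    · simp [hψ, hx]
  have hpt : ∀ s ∈ Ioc (0:ℝ) t, costDensity (a s) (vfun a g s) ≤
      ENNReal.ofReal (Real.log 2) * (ENNReal.ofReal (a s) * ψ (g s)) := by
    intro s hs
    have ha : 0 ≤ a s := h.nonneg_left s ⟨hs.1, hs.2.trans ht.2⟩
    unfold costDensity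
    by_cases h0 : a s = 0
    · simp [h0, vfun]
    · rw [if_neg h0]
      by_cases hg : 0 < g s
      · simp only [vfun, hψ, if_pos hg]
        rw [← ENNReal.ofReal_mul ha, ← ENNReal.ofReal_mul hlog.le, mul_pow,
          Real.sq_sqrt (by positivity)]
        refine ENNReal.ofReal_le_ofReal (le_of_eq ?_)
        field_simp
      · simp [vfun, hg]
  calc Ecost a (vfun a g) t = ∫⁻ s in Ioc (0:ℝ) t, costDensity (a s) (vfun a g s) := rfl
    _ ≤ ∫⁻ s in Ioc (0:ℝ) t, ENNReal.ofReal (Real.log 2) * (ENNReal.ofReal (a s) * ψ (g s)) :=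
        setLIntegral_mono' measurableSet_Ioc hpt
    _ = ENNReal.ofReal (Real.log 2) * ∫⁻ s in Ioc (0:ℝ) t, ENNReal.ofReal (a s) * ψ (g s) :=
        lintegral_const_mul' _ _ ENNReal.ofReal_ne_top
    _ ≤ ENNReal.ofReal (Real.log 2) * ENNReal.ofReal t := by
        gcongr
        exact h.lintegral_mul_inv_le ht hψm hψ1
    _ = ENNReal.ofReal (Real.log 2 * t) := (ENNReal.ofReal_mul hlog.le).symm

theorem lintegral_vfun (h : IsFlatMajorant a g) :
    ∫⁻ s in Ioc 0 1, ENNReal.ofReal (vfun a g s) =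
      ∫⁻ s in Ioc 0 1, ENNReal.ofReal (√(2 * Real.log 2) * √(g s)) := by
  set φ : ℝ → ENNReal := fun x => if 0 < x then ENNReal.ofReal √(2 * Real.log 2 / x) else 0 with hφ
  have hφm : Measurable φ := Measurable.ite measurableSet_Ioi (by fun_prop) measurable_const
  have key := h.lintegral_mul_comp hφm
  rw [setLIntegral_congr_fun (g := fun s => ENNReal.ofReal (vfun a g s)) measurableSet_Ioc
    fun s hs => ?_, setLIntegral_congr_fun (f := fun s => ENNReal.ofReal (g s) * φ (g s))
    (g := fun s => ENNReal.ofReal (√(2 * Real.log 2) * √(g s))) measurableSet_Ioc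
    fun s hs => ?_] at key
  · exact key
  · by_cases hg : 0 < g s
    · simp only [hφ, if_pos hg]
      rw [← ENNReal.ofReal_mul hg.le, Real.sqrt_div' _ hg.le]
      congr 1
      have : √(g s) ≠ 0 := (Real.sqrt_pos.2 hg).ne'
      field_simp
      rw [Real.sq_sqrt hg.le]
    · simp [hφ, hg, Real.sqrt_eq_zero_of_nonpos (not_lt.1 hg)]
  · by_cases hg : 0 < g s
    · simp only [hφ, vfun, if_pos hg]
      rw [← ENNReal.ofReal_mul (h.nonneg_left s hs)]
    · simp [hφ, vfun, hg]

theorem lintegral_sqrt_ne_top (h : IsFlatMajorant a g) (k : ℝ) :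
    ∫⁻ s in Ioc 0 1, ENNReal.ofReal (k * √(g s)) ≠ ⊤ := by
  have hanti : Antitone fun s => √(g s) := fun s t hst => Real.sqrt_le_sqrt (h.antitone hst)
  have hint : IntegrableOn (fun s => √(g s)) (Ioc 0 1) :=
    (hanti.locallyIntegrable.integrableOn_isCompact isCompact_Icc).mono_set Ioc_subset_Icc_self
  exact (hint.const_mul k).lintegral_lt_top.ne

theorem integral_vfun (h : IsFlatMajorant a g) :
    ∫ s in Ioc (0:ℝ) 1, vfun a g s = √(2 * Real.log 2) * ∫ s in Ioc (0:ℝ) 1, √(g s) := by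
  have hg : Measurable g := h.antitone.measurable
  rw [← integral_const_mul, integral_eq_lintegral_of_nonneg_ae, h.lintegral_vfun,
    integral_eq_lintegral_of_nonneg_ae]
  · exact Eventually.of_forall fun s => by positivity
  · exact (by fun_prop : Measurable fun s => √(2 * Real.log 2) * √(g s)).aestronglyMeasurable
  · exact (ae_restrict_iff' measurableSet_Ioc).2 (Eventually.of_forall fun s hs => h.vfun_nonneg hs)
  · exact h.aemeasurable_vfun.aestronglyMeasurable

theorem lintegral_le_of_memR (h : IsFlatMajorant a g) {b : ℝ → ℝ} (hb : memR a b) :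
    ∫⁻ s in Ioc 0 1, ENNReal.ofReal (b s) ≤
      ∫⁻ s in Ioc 0 1, ENNReal.ofReal (√(2 * Real.log 2) * √(g s)) := by
  have hlog : 0 < Real.log 2 := Real.log_pos one_lt_two
  have hg : Measurable g := h.antitone.measurable
  set k := √(2 * Real.log 2) with hk
  have hk0 : 0 < k := Real.sqrt_pos.2 (by positivity)
  have hk2 : k ^ 2 = 2 * Real.log 2 := Real.sq_sqrt (by positivity)
  have hbm : AEMeasurable b (volume.restrict (Ioc 0 1)) := by
    rw [restrict_Ioc_eq_restrict_Icc]
    exact hb.1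
  have hem : AEMeasurable (fun s => costDensity (a s) (b s)) (volume.restrict (Ioc 0 1)) :=
    measurable_costDensity.comp_aemeasurable (h.integrableOn_left.aemeasurable.prodMk hbm)
  have hE : ∀ t ∈ Icc (0:ℝ) 1, ∫⁻ s in Ioc 0 t, costDensity (a s) (b s) ≤
      ENNReal.ofReal (Real.log 2) * ENNReal.ofReal t := fun t ht => by
    rw [← ENNReal.ofReal_mul hlog.le]
    exact hb.2 t ht
  have hfin : ∀ᵐ s ∂volume.restrict (Ioc (0:ℝ) 1), costDensity (a s) (b s) < ⊤ := by
    refine ae_lt_top' hem (ne_top_of_le_ne_top ?_ (hE 1 ⟨zero_le_one, le_rfl⟩))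
    exact ENNReal.mul_ne_top ENNReal.ofReal_ne_top ENNReal.ofReal_ne_top
  set θ : ℝ → ℝ := fun s => √(g s) / k with hθ
  have hθanti : Antitone θ := fun s t hst =>
    div_le_div_of_nonneg_right (Real.sqrt_le_sqrt (h.antitone hst)) hk0.le
  have hθ0 : ∀ s, 0 ≤ θ s := fun s => by positivity
  set χ : ℝ → ENNReal := fun x => if 0 < x then ENNReal.ofReal (1 / (2 * (√x / k))) else 0 with hχ
  have hχm : Measurable χ := Measurable.ite measurableSet_Ioi (by fun_prop) measurable_const
  have hpt : ∀ᵐ s ∂volume.restrict (Ioc (0:ℝ) 1), ENNReal.ofReal (b s) ≤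
      costDensity (a s) (b s) * ENNReal.ofReal (θ s) + ENNReal.ofReal (a s) * χ (g s) := by
    filter_upwards [hfin, h.ae_eq_zero, ae_restrict_mem measurableSet_Ioc] with s hs1 hs2 hs
    by_cases hgs : 0 < g s
    · simp only [hχ, if_pos hgs]
      exact ofReal_le_costDensity_mul_add (h.nonneg_left s hs)
        (div_pos (Real.sqrt_pos.2 hgs) hk0)
    · have hb0 : b s = 0 := by
        by_contra hne
        simp [costDensity, hs2 (not_lt.1 hgs), hne] at hs1
      simp [hb0]
  calc ∫⁻ s in Ioc 0 1, ENNReal.ofReal (b s)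
      ≤ ∫⁻ s in Ioc 0 1, (costDensity (a s) (b s) * ENNReal.ofReal (θ s) +
          ENNReal.ofReal (a s) * χ (g s)) := lintegral_mono_ae hpt
    _ = (∫⁻ s in Ioc 0 1, costDensity (a s) (b s) * ENNReal.ofReal (θ s)) +
          ∫⁻ s in Ioc 0 1, ENNReal.ofReal (a s) * χ (g s) :=
        lintegral_add_right' _ (h.aemeasurable_ofReal_left.mul (hχm.comp hg).aemeasurable)
    _ ≤ ENNReal.ofReal (Real.log 2) * (∫⁻ s in Ioc 0 1, ENNReal.ofReal (θ s)) +
          ∫⁻ s in Ioc 0 1, ENNReal.ofReal (g s) * χ (g s) := by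
        rw [h.lintegral_mul_comp hχm]
        gcongr
        exact lintegral_mul_antitone_le hem hθanti hθ0 hE
    _ = ∫⁻ s in Ioc 0 1, (ENNReal.ofReal (Real.log 2) * ENNReal.ofReal (θ s) +
          ENNReal.ofReal (g s) * χ (g s)) := by
        rw [lintegral_add_left (by fun_prop), lintegral_const_mul' _ _ ENNReal.ofReal_ne_top]
    _ = ∫⁻ s in Ioc 0 1, ENNReal.ofReal (k * √(g s)) := by
        refine lintegral_congr fun s => ?_
        by_cases hgs : 0 < g s
        · have hr : 0 < √(g s) := Real.sqrt_pos.2 hgs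
          simp only [hχ, hθ, if_pos hgs]
          rw [← ENNReal.ofReal_mul hlog.le, ← ENNReal.ofReal_mul hgs.le,
            ← ENNReal.ofReal_add (by positivity) (by positivity)]
          congr 1
          have hlog2 : Real.log 2 = k ^ 2 / 2 := by linarith
          rw [hlog2]
          nth_rewrite 2 [← Real.sq_sqrt hgs.le]
          field_simp
          ring
        · simp [hχ, hθ, hgs, Real.sqrt_eq_zero_of_nonpos (not_lt.1 hgs)]

theorem integral_le_of_memR (h : IsFlatMajorant a g) {b : ℝ → ℝ} (hb : memR a b) :
    ∫ s in Ioc (0:ℝ) 1, b s ≤ ∫ s in Ioc (0:ℝ) 1, vfun a g s := by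
  have hle := (h.lintegral_le_of_memR hb).trans_eq h.lintegral_vfun.symm
  have htop : ∫⁻ s in Ioc 0 1, ENNReal.ofReal (vfun a g s) ≠ ⊤ := by
    rw [h.lintegral_vfun]
    exact h.lintegral_sqrt_ne_top _
  refine (integral_le_toReal_lintegral _ b).trans ?_
  rw [integral_eq_lintegral_of_nonneg_ae _ h.aemeasurable_vfun.aestronglyMeasurable]
  · exact ENNReal.toReal_mono htop hle
  · exact (ae_restrict_iff' measurableSet_Ioc).2 (Eventually.of_forall fun s hs => h.vfun_nonneg hs)

end IsFlatMajorant

theorem memR_congr {a b c : ℝ → ℝ} (hbc : EqOn b c (Ioc 0 1)) (hc : memR a c) : memR a b := by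
  refine ⟨?_, fun t ht => ?_⟩
  · have hm := hc.1
    rw [← restrict_Ioc_eq_restrict_Icc] at hm ⊢
    exact hm.congr ((ae_restrict_iff' measurableSet_Ioc).2
      (Eventually.of_forall fun s hs => (hbc hs).symm))
  · refine le_of_eq_of_le (setLIntegral_congr_fun measurableSet_Ioc fun s hs => ?_) (hc.2 t ht)
    simp only [hbc ⟨hs.1, hs.2.trans ht.2⟩]

theorem stmt9 (a A Ahat ahat : ℝ → ℝ)
    (ha_nonneg : ∀ s ∈ Set.Icc (0:ℝ) 1, 0 ≤ a s)
    (ha_int : RiemannIntegrableOn01 a)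
    (hA : ∀ t ∈ Set.Icc (0:ℝ) 1, A t = ∫ s in (0:ℝ)..t, a s)
    (hA1 : A 1 = 1)
    (hAhat_conc : ConcaveOn ℝ (Set.Icc 0 1) Ahat)
    (hAhat_ge : ∀ t ∈ Set.Icc (0:ℝ) 1, A t ≤ Ahat t)
    (hAhat_least : ∀ g : ℝ → ℝ, ConcaveOn ℝ (Set.Icc 0 1) g →
      (∀ t ∈ Set.Icc (0:ℝ) 1, A t ≤ g t) → ∀ t ∈ Set.Icc (0:ℝ) 1, Ahat t ≤ g t)
    (hahat_deriv : ∀ t ∈ Set.Ioc (0:ℝ) 1, HasDerivWithinAt Ahat (ahat t) (Set.Iic t) t)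
    (hahat_nonneg : ∀ t ∈ Set.Ioc (0:ℝ) 1, 0 ≤ ahat t)
    (hahat_anti : AntitoneOn ahat (Set.Ioc 0 1)) :
    memR a (vfun a ahat) ∧
    (∀ b : ℝ → ℝ, memR a b →
      (∫ t in Set.Ioc (0:ℝ) 1, b t) ≤ ∫ t in Set.Ioc (0:ℝ) 1, vfun a ahat t) ∧
    (∫ t in Set.Ioc (0:ℝ) 1, vfun a ahat t) =
      Real.sqrt (2 * Real.log 2) * ∫ t in Set.Ioc (0:ℝ) 1, Real.sqrt (ahat t) := by
  obtain ⟨ha_I, -, C, hC⟩ := ha_int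
  obtain ⟨g, hg, hflat⟩ := exists_isFlatMajorant_of_least_concave ha_nonneg ha_I
    (fun s hs => (le_abs_self _).trans (hC s hs)) hAhat_conc
    (fun t ht => hA t ht ▸ hAhat_ge t ht)
    (fun f hf hle => hAhat_least f hf fun t ht => (hA t ht).symm ▸ hle t ht)
    hahat_deriv hahat_nonneg hahat_anti
  have hv : EqOn (vfun a ahat) (vfun a g) (Ioc 0 1) := fun s hs => by simp only [vfun, hg hs]
  have hsqrt : EqOn (fun t => √(ahat t)) (fun t => √(g t)) (Ioc 0 1) := fun s hs => by
    simp only [hg hs]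
  rw [setIntegral_congr_fun measurableSet_Ioc hv, setIntegral_congr_fun measurableSet_Ioc hsqrt]
  exact ⟨memR_congr hv hflat.memR_vfun, fun b hb => hflat.integral_le_of_memR hb,
    hflat.integral_vfun⟩
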